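/- Let n ≥ 3, m = n − 1, and B = {n}, and let f : 𝔽₂ⁿ → 𝔽₂ be defined by f(x) = 1 if and only if supp(x) is a nonempty down-closed subset of ℍ(n−1,n) contained in [n−1] ∪ {n} = [n]. Then the code C_f has length 2ⁿ − 1; the map (s,u) ↦ c_f(s,u) is injective (so C_f has 2^{n+1} codewords and dimension n + 1); the minimum weight of a nonzero codeword is 2^{n−1} − 2; and Σ_{i=0}^{n} ⌈(2^{n−1} − 1)/2^i⌉ = 2ⁿ − 1, so a [2ⁿ − 1, n + 1, 2^{n−1} − 1] binary code would meet the Griesmer bound with equality; hence C_f is an almost distance-optimal [2ⁿ − 1, n + 1, 2^{n−1} − 2] code. -/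

import Mathlib

open Finset

/-- The order relation of the hierarchical poset `ℍ(m,n)` on `Fin n`:
`i ⪯ j` iff `i = j`, or `i` lies in the bottom level `[m]` and `j` in the top level. -/
def Hle (n m : ℕ) (i j : Fin n) : Prop :=
  i = j ∨ ((i : ℕ) < m ∧ m ≤ (j : ℕ))

instance (n m : ℕ) : DecidableRel (Hle n m) := fun i j =>
  decidable_of_iff (i = j ∨ ((i : ℕ) < m ∧ m ≤ (j : ℕ))) Iff.rfl

/-- Down-closed subsets of the hierarchical poset `ℍ(m,n)`. -/
def HDownClosed (n m : ℕ) (S : Finset (Fin n)) : Prop :=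
  ∀ i j : Fin n, Hle n m i j → j ∈ S → i ∈ S

instance (n m : ℕ) : DecidablePred (HDownClosed n m) := fun S =>
  decidable_of_iff (∀ i j : Fin n, Hle n m i j → j ∈ S → i ∈ S) Iff.rfl

/-- The bottom level `[m]` of `ℍ(m,n)`, viewed inside `Fin n`. -/
def lowSet (n m : ℕ) : Finset (Fin n) :=
  Finset.univ.filter (fun i => (i : ℕ) < m)

/-- The support of a vector of `𝔽₂ⁿ`, as a subset of `[n]`. -/
def supp {n : ℕ} (x : Fin n → ZMod 2) : Finset (Fin n) :=
  Finset.univ.filter (fun i => x i ≠ 0)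

/-- The standard inner product on `𝔽₂ⁿ`. -/
def ip {n : ℕ} (u x : Fin n → ZMod 2) : ZMod 2 := ∑ i, u i * x i

/-- The Hamming weight of the codeword `c_{D,u} = (u·x)_{x ∈ D}`. -/
def wtD {n : ℕ} (D : Finset (Fin n → ZMod 2)) (u : Fin n → ZMod 2) : ℕ :=
  (D.filter (fun x => ip u x = 1)).card

/-- The Hamming weight of the codeword `c_f(s,u) = (s·f(x) + u·x)_{x ∈ 𝔽₂ⁿ ∖ {0}}`. -/
def wtF {n : ℕ} (f : (Fin n → ZMod 2) → ZMod 2) (s : ZMod 2) (u : Fin n → ZMod 2) : ℕ :=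
  (Finset.univ.filter (fun x : Fin n → ZMod 2 => x ≠ 0 ∧ s * f x + ip u x = 1)).card

/-- The Hamming weight of the first `m` coordinates of `u` (the part `v` of `u = (v,w)`). -/
def wtLow (n m : ℕ) (u : Fin n → ZMod 2) : ℕ :=
  (Finset.univ.filter (fun i : Fin n => (i : ℕ) < m ∧ u i ≠ 0)).card


lemma aux_zmod2 (a : ZMod 2) : a = 0 ∨ a = 1 := by
  revert a; decide

lemma ip_add_left {n : ℕ} (u v x : Fin n → ZMod 2) : ip (u + v) x = ip u x + ip v x := by
  simp [ip, add_mul, Finset.sum_add_distrib]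

lemma ip_add_right {n : ℕ} (u x y : Fin n → ZMod 2) : ip u (x + y) = ip u x + ip u y := by
  simp [ip, mul_add, Finset.sum_add_distrib]

lemma ip_single_left {n : ℕ} (i : Fin n) (x : Fin n → ZMod 2) : ip (Pi.single i 1) x = x i := by
  simp [ip, Pi.single_apply]

lemma ip_single_right {n : ℕ} (i : Fin n) (x : Fin n → ZMod 2) : ip x (Pi.single i 1) = x i := by
  simp [ip, Pi.single_apply]

lemma ip_zero_right {n : ℕ} (u : Fin n → ZMod 2) : ip u 0 = 0 := by simp [ip]

lemma ip_zero_left {n : ℕ} (u : Fin n → ZMod 2) : ip 0 u = 0 := by simp [ip]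

lemma card_all (n : ℕ) : (Finset.univ : Finset (Fin n → ZMod 2)).card = 2 ^ n := by
  simp [ZMod.card]

lemma card_half {n : ℕ} (v : Fin n → ZMod 2) (hv : v ≠ 0) :
    (univ.filter (fun x => ip v x = 0)).card = 2 ^ (n - 1) ∧
    (univ.filter (fun x => ip v x = 1)).card = 2 ^ (n - 1) := by
  obtain ⟨i, hi⟩ := Function.ne_iff.mp hv
  have hi1 : v i = 1 := (aux_zmod2 (v i)).resolve_left hi
  have h11 : (1 : ZMod 2) + 1 = 0 := by decide
  have hdd : ∀ x : Fin n → ZMod 2, x + Pi.single i 1 + Pi.single i 1 = x := by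
    intro x
    rw [add_assoc, ← Pi.single_add, h11, Pi.single_zero, add_zero]
  have hEq : (univ.filter (fun x => ip v x = 0)).card
      = (univ.filter (fun x => ip v x = 1)).card := by
    refine Finset.card_bij' (fun x _ => x + Pi.single i 1) (fun x _ => x + Pi.single i 1)
      ?_ ?_ ?_ ?_
    · intro x hx
      simp only [mem_filter, mem_univ, true_and] at hx ⊢
      rw [ip_add_right, ip_single_right, hx, hi1, zero_add]
    · intro x hx
      simp only [mem_filter, mem_univ, true_and] at hx ⊢
      rw [ip_add_right, ip_single_right, hx, hi1, h11]
    · intro x _; exact hdd x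
    · intro x _; exact hdd x
  have hsum := Finset.card_filter_add_card_filter_not (s := (univ : Finset (Fin n → ZMod 2)))
    (fun x => ip v x = 0)
  have hnot : (univ.filter (fun x => ¬ ip v x = 0)) = univ.filter (fun x => ip v x = 1) := by
    ext x
    simp only [mem_filter, mem_univ, true_and]
    rcases aux_zmod2 (ip v x) with h | h <;> simp [h]
  rw [hnot, card_all] at hsum
  have hn : n = (n - 1) + 1 := by have := i.pos; omega
  have hp : 2 ^ n = 2 * 2 ^ (n - 1) := by
    conv_lhs => rw [hn]
    ring
  omega

lemma f_form (k : ℕ) (f : (Fin (k + 1) → ZMod 2) → ZMod 2)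
    (hf : ∀ x, f x = 1 ↔ ((supp x).Nonempty ∧ HDownClosed (k + 1) k (supp x)))
    (x : Fin (k + 1) → ZMod 2) (hx : x ≠ 0) :
    f x = 1 ↔ (x (Fin.last k) = 0 ∨ x = 1) := by
  rw [hf]
  have hne : (supp x).Nonempty := by
    obtain ⟨i, hi⟩ := Function.ne_iff.mp hx
    exact ⟨i, by simpa [supp] using hi⟩
  rw [and_iff_right hne]
  simp only [true_and, HDownClosed, Hle, supp, mem_filter, mem_univ]
  constructor
  · intro h
    by_cases hl : x (Fin.last k) = 0
    · exact Or.inl hl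
    · right
      funext i
      refine (aux_zmod2 (x i)).resolve_left ?_
      by_cases hi : i = Fin.last k
      · rwa [hi]
      · exact h i (Fin.last k) (Or.inr ⟨by
          have := Fin.val_lt_last hi
          simpa using this, by simp⟩) hl
  · rintro (h | h) i j hij hj
    · rcases hij with rfl | ⟨_, h2⟩
      · exact hj
      · exfalso
        have : j = Fin.last k := by
          apply Fin.ext
          have := j.isLt
          simp only [Fin.val_last]
          omega
        exact hj (this ▸ h)
    · subst h; simp

/-- The weight of `c_f(1,u)` in terms of the vector `v = u + e_n`. -/
lemma wt_one (k : ℕ) (f : (Fin (k + 1) → ZMod 2) → ZMod 2)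
    (hf : ∀ x, f x = 1 ↔ ((supp x).Nonempty ∧ HDownClosed (k + 1) k (supp x)))
    (u : Fin (k + 1) → ZMod 2) :
    (ip (u + Pi.single (Fin.last k) 1) 1 = 0 →
      wtF f 1 u = (univ.filter (fun x => ip (u + Pi.single (Fin.last k) 1) x = 0)).card - 2) ∧
    (ip (u + Pi.single (Fin.last k) 1) 1 = 1 →
      wtF f 1 u = (univ.filter (fun x => ip (u + Pi.single (Fin.last k) 1) x = 0)).card) := by
  have key : ∀ x : Fin (k + 1) → ZMod 2, x ≠ 0 → (1 * f x + ip u x = 1 ↔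
      (if x = 1 then ip (u + Pi.single (Fin.last k) 1) x = 1
        else ip (u + Pi.single (Fin.last k) 1) x = 0)) := by
    intro x hx
    have h := f_form k f hf x hx
    rw [ip_add_left, ip_single_left]
    by_cases h1 : x = 1
    · have hf1 : f x = 1 := h.mpr (Or.inr h1)
      have hl : x (Fin.last k) = 1 := by rw [h1]; rfl
      rw [if_pos h1, hf1, hl]
      generalize ip u x = a
      revert a; decide
    · rw [if_neg h1]
      simp only [h1, or_false] at h
      revert h
      generalize ip u x = a
      generalize f x = b
      generalize x (Fin.last k) = c
      revert a b c; decide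
  have h10 : (1 : Fin (k + 1) → ZMod 2) ≠ 0 := one_ne_zero
  generalize u + Pi.single (Fin.last k) 1 = v at key ⊢
  constructor
  · intro hv
    have : (univ.filter (fun x : Fin (k + 1) → ZMod 2 => x ≠ 0 ∧ 1 * f x + ip u x = 1))
        = ((univ.filter (fun x => ip v x = 0)).erase 0).erase 1 := by
      ext x
      simp only [mem_filter, mem_univ, true_and, mem_erase]
      by_cases hx : x = 0
      · simp [hx]
      · rw [key x hx]
        by_cases h1 : x = 1
        · subst h1; simp [hv]
        · simp [h1, hx]
    rw [wtF, this, card_erase_of_mem (by simp [h10, hv]),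
      card_erase_of_mem (by simp [ip_zero_right])]
    omega
  · intro hv
    have : (univ.filter (fun x : Fin (k + 1) → ZMod 2 => x ≠ 0 ∧ 1 * f x + ip u x = 1))
        = insert 1 ((univ.filter (fun x => ip v x = 0)).erase 0) := by
      ext x
      simp only [mem_filter, mem_univ, true_and, mem_erase, mem_insert]
      by_cases h1 : x = 1
      · subst h1; rw [key 1 h10]; simp [hv]
      · by_cases hx : x = 0
        · subst hx; simpa using h1
        · rw [key x hx]; simp [h1, hx]
    have hmem : (0 : Fin (k + 1) → ZMod 2) ∈ univ.filter (fun x => ip v x = 0) := by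
      simp [ip_zero_right]
    rw [wtF, this, card_insert_of_notMem (by simp [hv]), card_erase_of_mem hmem]
    have := Finset.card_pos.mpr ⟨_, hmem⟩
    omega

lemma wt_zero {n : ℕ} (f : (Fin n → ZMod 2) → ZMod 2) (u : Fin n → ZMod 2) :
    wtF f 0 u = (univ.filter (fun x => ip u x = 1)).card := by
  unfold wtF
  congr 1
  ext x
  simp only [mem_filter, mem_univ, true_and, zero_mul, zero_add, and_iff_right_iff_imp]
  rintro h rfl
  simp [ip_zero_right] at h

lemma wt_lower (k : ℕ) (f : (Fin (k + 1) → ZMod 2) → ZMod 2)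
    (hf : ∀ x, f x = 1 ↔ ((supp x).Nonempty ∧ HDownClosed (k + 1) k (supp x)))
    (s : ZMod 2) (u : Fin (k + 1) → ZMod 2) (hsu : s ≠ 0 ∨ u ≠ 0) :
    2 ^ k - 2 ≤ wtF f s u := by
  rcases aux_zmod2 s with rfl | rfl
  · have hu : u ≠ 0 := by simpa using hsu
    rw [wt_zero, (card_half u hu).2]
    simp
  · have h := wt_one k f hf u
    have hc : 2 ^ k ≤ (univ.filter (fun x => ip (u + Pi.single (Fin.last k) 1) x = 0)).card := by
      by_cases hv : u + Pi.single (Fin.last k) 1 = 0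
      · rw [hv]
        simp only [ip_zero_left, filter_true, card_all]
        exact Nat.pow_le_pow_right (by norm_num) (by omega)
      · rw [(card_half _ hv).1]; simp
    rcases aux_zmod2 (ip (u + Pi.single (Fin.last k) 1) 1) with h0 | h0
    · rw [h.1 h0]; omega
    · rw [h.2 h0]; omega

lemma griesmer_sum (k : ℕ) (hk : 2 ≤ k) :
    ∑ i ∈ Finset.range (k + 1 + 1), (2 ^ k - 1 + 2 ^ i - 1) / 2 ^ i = 2 ^ (k + 1) - 1 := by
  have h4 : 2 ^ 2 ≤ 2 ^ k := Nat.pow_le_pow_right (by norm_num) hk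
  rw [Finset.sum_range_succ, Finset.sum_range_succ']
  have hlast : (2 ^ k - 1 + 2 ^ (k + 1) - 1) / 2 ^ (k + 1) = 1 := by
    rw [Nat.div_eq_iff (by positivity)]
    rw [pow_succ]
    omega
  have hmid : ∑ i ∈ Finset.range k, (2 ^ k - 1 + 2 ^ (i + 1) - 1) / 2 ^ (i + 1)
      = ∑ i ∈ Finset.range k, 2 ^ (k - 1 - i) := by
    apply Finset.sum_congr rfl
    intro i hi
    have hik := Finset.mem_range.mp hi
    have e : 2 ^ k = 2 ^ (k - 1 - i) * 2 ^ (i + 1) := by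
      rw [← pow_add]; congr 1; omega
    have hp : 2 ≤ 2 ^ (i + 1) := by
      have := Nat.one_le_two_pow (n := i)
      rw [pow_succ]; omega
    rw [Nat.div_eq_iff (by positivity)]
    rw [e] at h4 ⊢
    omega
  rw [hlast, hmid, Finset.sum_range_reflect (fun i => 2 ^ i) k, Nat.geomSum_eq (by norm_num)]
  rw [pow_succ]
  simp
  omega

/-- **Theorem 6.3(1).**  For `n ≥ 3`, `m = n−1`, `B = {n}`, let `f` be the
indicator of the nonempty down-closed subsets of `ℍ(n−1,n)` (all of which are
contained in `[n−1] ∪ {n} = [n]`).  Then `C_f` is an almost distance-optimal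
`[2ⁿ − 1, n + 1, 2^{n−1} − 2]` code: its length is `2ⁿ − 1`, the map
`(s,u) ↦ c_f(s,u)` is injective (dimension `n+1`), the minimum nonzero codeword
weight is `2^{n−1} − 2`, and `Σ_{i=0}^{n} ⌈(2^{n−1} − 1)/2ⁱ⌉ = 2ⁿ − 1`, so a
`[2ⁿ − 1, n + 1, 2^{n−1} − 1]` code would meet the Griesmer bound with equality. -/
theorem stmt_17 (n : ℕ) (hn : 3 ≤ n)
    (f : (Fin n → ZMod 2) → ZMod 2)
    (hf : ∀ x, f x = 1 ↔ ((supp x).Nonempty ∧ HDownClosed n (n - 1) (supp x))) :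
    (Finset.univ.filter (fun x : Fin n → ZMod 2 => x ≠ 0)).card = 2 ^ n - 1
    ∧ (∀ (s₁ s₂ : ZMod 2) (u₁ u₂ : Fin n → ZMod 2),
        (∀ x : Fin n → ZMod 2, x ≠ 0 → s₁ * f x + ip u₁ x = s₂ * f x + ip u₂ x) →
        s₁ = s₂ ∧ u₁ = u₂)
    ∧ (∀ (s : ZMod 2) (u : Fin n → ZMod 2), wtF f s u ≠ 0 →
        2 ^ (n - 1) - 2 ≤ wtF f s u)
    ∧ (∃ (s : ZMod 2) (u : Fin n → ZMod 2), wtF f s u = 2 ^ (n - 1) - 2)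
    ∧ ∑ i ∈ Finset.range (n + 1), (2 ^ (n - 1) - 1 + 2 ^ i - 1) / 2 ^ i
        = 2 ^ n - 1 := by
  obtain ⟨k, rfl⟩ : ∃ k, n = k + 1 := ⟨n - 1, by omega⟩
  simp only [Nat.add_sub_cancel] at hf ⊢
  have hk : 2 ≤ k := by omega
  have h4 : 2 ^ 2 ≤ 2 ^ k := Nat.pow_le_pow_right (by norm_num) hk
  refine ⟨?_, ?_, ?_, ?_, griesmer_sum k hk⟩
  · rw [Finset.filter_ne', card_erase_of_mem (mem_univ _), card_all]
  · intro s₁ s₂ u₁ u₂ h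
    by_contra hcon
    have hsu : s₁ - s₂ ≠ 0 ∨ u₁ - u₂ ≠ 0 := by
      rw [sub_ne_zero, sub_ne_zero]
      tauto
    have hlow := wt_lower k f hf _ _ hsu
    have hz : wtF f (s₁ - s₂) (u₁ - u₂) = 0 := by
      rw [wtF, Finset.card_eq_zero, Finset.filter_eq_empty_iff]
      rintro x - ⟨hx, h1⟩
      have h2 := h x hx
      have h3 : ip (u₁ - u₂) x = ip u₁ x - ip u₂ x := by
        simp [ip, sub_mul, Finset.sum_sub_distrib]
      rw [h3] at h1
      have : (s₁ - s₂) * f x + (ip u₁ x - ip u₂ x) = 0 := by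
        linear_combination h2
      rw [this] at h1
      exact zero_ne_one h1
    omega
  · intro s u hw
    apply wt_lower k f hf
    by_contra hcon
    push Not at hcon
    obtain ⟨rfl, rfl⟩ := hcon
    apply hw
    rw [wt_zero]
    simp [ip_zero_left]
  · let v : Fin (k + 1) → ZMod 2 := Pi.single 0 1 + Pi.single (Fin.last k) 1
    have hl : (0 : Fin (k + 1)) ≠ Fin.last k := by
      intro h
      have := congrArg Fin.val h
      simp at this
      omega
    have h11 : (1 : ZMod 2) + 1 = 0 := by decide
    refine ⟨1, Pi.single 0 1, ?_⟩
    have hv : v ≠ 0 := by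
      intro h
      have := congrFun h 0
      simp [v, Pi.single_apply, hl] at this
    have hv1 : ip v 1 = 0 := by
      simp only [v, ip_add_left, ip_single_left, Pi.one_apply, h11]
    rw [(wt_one k f hf (Pi.single 0 1)).1 hv1, (card_half v hv).1]
    simp
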